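/- If P is a rectangular finite poset of width w and height h, then for every finite poset Q the maximum size of a semiantichain in P×Q equals the minimum number of unichains needed to cover P×Q, and this common value is w·d_h(Q). -/

import Mathlib

/-- A *unichain* in the product of two posets: a chain of the form `{p} × C`
or `C × {q}`. -/
def IsUnichain {α β : Type*} [PartialOrder α] [PartialOrder β] (U : Set (α × β)) : Prop :=
  (∃ (p : α) (C : Set β), IsChain (· ≤ ·) C ∧ U = ({p} : Set α) ×ˢ C) ∨
  (∃ (q : β) (C : Set α), IsChain (· ≤ ·) C ∧ U = C ×ˢ ({q} : Set β))

/-- A *semiantichain*: no two distinct elements lie in a common unichain. -/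
def IsSemiantichain {α β : Type*} [PartialOrder α] [PartialOrder β] (S : Set (α × β)) : Prop :=
  ∀ x ∈ S, ∀ y ∈ S, x ≠ y → ∀ U : Set (α × β), IsUnichain U → ¬(x ∈ U ∧ y ∈ U)

/-- The maximum size of a semiantichain in `α × β`. -/
noncomputable def maxSemiantichain (α β : Type*) [PartialOrder α] [PartialOrder β] : ℕ :=
  sSup {n | ∃ S : Set (α × β), IsSemiantichain S ∧ S.ncard = n}

/-- The minimum number of unichains needed to cover `α × β`. -/
noncomputable def minUnichainCover (α β : Type*) [PartialOrder α] [PartialOrder β] : ℕ :=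
  sInf {n | ∃ U : Fin n → Set (α × β), (∀ i, IsUnichain (U i)) ∧ (⋃ i, U i) = Set.univ}

/-- Height: maximum size of a chain. -/
noncomputable def heightP (α : Type*) [PartialOrder α] : ℕ :=
  sSup {n | ∃ C : Set α, IsChain (· ≤ ·) C ∧ C.ncard = n}

/-- Width: maximum size of an antichain. -/
noncomputable def widthP (α : Type*) [PartialOrder α] : ℕ :=
  sSup {n | ∃ A : Set α, IsAntichain (· ≤ ·) A ∧ A.ncard = n}

/-- `dk α k`: maximum size of a union of `k` antichains. -/
noncomputable def dk (α : Type*) [PartialOrder α] (k : ℕ) : ℕ :=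
  sSup {n | ∃ A : Fin k → Set α, (∀ i, IsAntichain (· ≤ ·) (A i)) ∧ (⋃ i, A i).ncard = n}

/-- `ck α k`: maximum size of a union of `k` chains. -/
noncomputable def ck (α : Type*) [PartialOrder α] (k : ℕ) : ℕ :=
  sSup {n | ∃ C : Fin k → Set α, (∀ i, IsChain (· ≤ ·) (C i)) ∧ (⋃ i, C i).ncard = n}

/-- `P` is d-decomposable: it has an antichain partition `A_1, …, A_{h(P)}`
with `|A_1 ∪ … ∪ A_k| = d_k(P)` for every `k ≤ h(P)`. -/
def DDecomposable (α : Type*) [PartialOrder α] : Prop :=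
  ∃ A : Fin (heightP α) → Set α,
    (∀ i, IsAntichain (· ≤ ·) (A i)) ∧
    (∀ i j, i ≠ j → Disjoint (A i) (A j)) ∧
    (⋃ i, A i) = Set.univ ∧
    ∀ k, k ≤ heightP α →
      (⋃ i : Fin (heightP α), ⋃ (_ : (i : ℕ) < k), A i).ncard = dk α k

/-- `P` is c-decomposable: it has a chain partition `C_1, …, C_{w(P)}`
with `|C_1 ∪ … ∪ C_k| = c_k(P)` for every `k ≤ w(P)`. -/
def CDecomposable (α : Type*) [PartialOrder α] : Prop :=
  ∃ C : Fin (widthP α) → Set α,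
    (∀ i, IsChain (· ≤ ·) (C i)) ∧
    (∀ i j, i ≠ j → Disjoint (C i) (C j)) ∧
    (⋃ i, C i) = Set.univ ∧
    ∀ k, k ≤ widthP α →
      (⋃ i : Fin (widthP α), ⋃ (_ : (i : ℕ) < k), C i).ncard = ck α k

/-- `P` is *rectangular* of width `w` and height `h`: its order contains, on the
same ground set, the order of a disjoint union of `w` chains each of size `h`
(labelled via an equivalence with `Fin w × Fin h`), and it is contained in the
order of a weak order of height `h` all of whose levels have size `w`. -/
def IsRectangular (α : Type*) [Fintype α] [PartialOrder α] (w h : ℕ) : Prop :=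
  (∃ f : α ≃ Fin w × Fin h,
      ∀ a b : α, (f a).1 = (f b).1 → (f a).2 ≤ (f b).2 → a ≤ b) ∧
  (∃ g : α → Fin h,
      (∀ j : Fin h, (Finset.univ.filter fun a : α => g a = j).card = w) ∧
      ∀ a b : α, a ≤ b → a = b ∨ g a < g b)

/-- Integral weighted bipartite matching duality (Egerváry). -/
theorem egervary_aux {β : Type} [Fintype β] [DecidableEq β] (W : β → β → ℤ) :
    ∃ (σ : Equiv.Perm β) (u v : β → ℤ), (∀ i j, W i j ≤ u i + v j) ∧
      ∀ i, W i (σ i) = u i + v (σ i) := by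
  classical
  let Pf : ℕ → Prop := fun n => ∃ u v : β → ℤ, (∀ i j, W i j ≤ u i + v j) ∧
    ∑ i, (u i + v i - W i i) = n
  have hex : ∃ n, Pf n := by
    let M : ℤ := ∑ i, ∑ j, |W i j|
    have hM : ∀ i j, W i j ≤ M := by
      intro i j
      calc W i j ≤ |W i j| := le_abs_self _
        _ ≤ ∑ j, |W i j| := Finset.single_le_sum (f := fun j => |W i j|)
            (fun _ _ => abs_nonneg _) (Finset.mem_univ j)
        _ ≤ M := Finset.single_le_sum (f := fun i => ∑ j, |W i j|)
            (fun _ _ => Finset.sum_nonneg fun _ _ => abs_nonneg _) (Finset.mem_univ i)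
    refine ⟨(∑ i, (M + 0 - W i i)).toNat, fun _ => M, fun _ => 0, ?_, ?_⟩
    · intro i j; simpa using hM i j
    · rw [Int.toNat_of_nonneg]
      exact Finset.sum_nonneg fun i _ => by linarith [hM i i]
  obtain ⟨u, v, huv, hsum⟩ := Nat.find_spec hex
  have hmin : ∀ u' v' : β → ℤ, (∀ i j, W i j ≤ u' i + v' j) →
      ∑ i, (u i + v i) ≤ ∑ i, (u' i + v' i) := by
    intro u' v' h'
    have hnn : 0 ≤ ∑ i, (u' i + v' i - W i i) :=
      Finset.sum_nonneg fun i _ => by linarith [h' i i]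
    have := Nat.find_min' hex (m := (∑ i, (u' i + v' i - W i i)).toNat)
      ⟨u', v', h', by rw [Int.toNat_of_nonneg hnn]⟩
    have h2 : (Nat.find hex : ℤ) ≤ ∑ i, (u' i + v' i - W i i) := by omega
    rw [← hsum, Finset.sum_sub_distrib, Finset.sum_sub_distrib] at h2
    linarith
  let t : β → Finset β := fun i => Finset.univ.filter fun j => W i j = u i + v j
  have hall : ∀ s : Finset β, s.card ≤ (s.biUnion t).card := by
    intro s
    have := hmin (fun i => u i - if i ∈ s then 1 else 0)
      (fun j => v j + if j ∈ s.biUnion t then 1 else 0) (by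
        intro i j
        have h0 := huv i j
        by_cases hi : i ∈ s
        · by_cases hj : j ∈ s.biUnion t
          · simp only [hi, hj, if_true]; linarith
          · have hne : W i j ≠ u i + v j := by
              intro h; exact hj (Finset.mem_biUnion.2 ⟨i, hi, by simp [t, h]⟩)
            simp only [hi, hj, if_true, if_false]
            omega
        · simp only [hi, if_false]
          split_ifs <;> linarith)
    simp only [Finset.sum_add_distrib, Finset.sum_sub_distrib, Finset.sum_ite_mem,
      Finset.univ_inter, Finset.sum_const, nsmul_eq_mul, mul_one] at this
    have h3 : (s.card : ℤ) ≤ (s.biUnion t).card := by linarith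
    exact_mod_cast h3
  obtain ⟨f, hf, hft⟩ := (Finset.all_card_le_biUnion_card_iff_exists_injective t).1 hall
  refine ⟨Equiv.ofBijective f (Finite.injective_iff_bijective.1 hf), u, v, huv, ?_⟩
  intro i
  have := hft i
  simpa [t] using this

theorem dk_bdd (β : Type) [Fintype β] [PartialOrder β] (k : ℕ) :
    BddAbove {n | ∃ A : Fin k → Set β, (∀ i, IsAntichain (· ≤ ·) (A i)) ∧
      (⋃ i, A i).ncard = n} := by
  refine ⟨Nat.card β, ?_⟩
  rintro n ⟨A, -, rfl⟩
  exact Set.ncard_le_card _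

/-- Greene–Kleitman style covering. -/
theorem greene_kleitman_aux (β : Type) [Fintype β] [PartialOrder β] (k : ℕ) (hk : 0 < k) :
    ∃ (R E : Finset β) (C : β → Set β), (∀ e, IsChain (· ≤ ·) (C e)) ∧
      (∀ q, q ∈ R ∨ ∃ e ∈ E, q ∈ C e) ∧ R.card + k * E.card ≤ dk β k := by
  classical
  let W : β → β → ℤ := fun a b => if a < b then (k : ℤ) else if a = b then (k : ℤ) - 1 else 0
  have hW0 : ∀ a b, 0 ≤ W a b := by
    intro a b; simp only [W]; split_ifs <;> omega
  obtain ⟨σ, u, v, huv, ht⟩ := egervary_aux W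
  let r : β → β → Prop := fun a b => a < σ a ∧ b = σ a
  let R : Finset β := Finset.univ.filter fun q => σ q = q
  let T : Finset β := Finset.univ.filter fun q => q < σ q
  let E : Finset β := Finset.univ.filter fun q => ¬ q < σ q ∧ σ q ≠ q
  have hle : ∀ a b, Relation.ReflTransGen r a b → a ≤ b := by
    intro a b hab
    induction hab with
    | refl => exact le_rfl
    | tail _ h ih => exact ih.trans (by rw [h.2]; exact h.1.le)
  refine ⟨R, E, fun e => {q | Relation.ReflTransGen r q e}, ?_, ?_, ?_⟩
  · intro e a ha b hb _
    have ha' := Relation.reflTransGen_swap.2 (show Relation.ReflTransGen r a e from ha)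
    have hb' := Relation.reflTransGen_swap.2 (show Relation.ReflTransGen r b e from hb)
    have hu : Relator.RightUnique (Function.swap r) := by
      intro x y z hy hz
      exact σ.injective (hy.2.symm.trans hz.2)
    rcases Relation.ReflTransGen.total_of_right_unique hu ha' hb' with h | h
    · exact Or.inr (hle _ _ (Relation.reflTransGen_swap.1 h))
    · exact Or.inl (hle _ _ (Relation.reflTransGen_swap.1 h))
  · intro q
    induction q using WellFoundedGT.induction with
    | ind q ih =>
      by_cases hR : σ q = q
      · left; simp [R, hR]
      by_cases hT : q < σ q
      · right
        rcases ih _ hT with h | ⟨e, he, h⟩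
        · simp only [R, Finset.mem_filter, Finset.mem_univ, true_and] at h
          exact absurd (σ.injective h) hR
        · exact ⟨e, he, Relation.ReflTransGen.head ⟨hT, rfl⟩ h⟩
      · right
        exact ⟨q, by simp [E, hR, hT], Relation.ReflTransGen.refl⟩
  · -- shift the potentials
    obtain ⟨c, hcu, hcv⟩ : ∃ c : ℤ, (∀ q, c ≤ u q) ∧ ∀ q, 0 ≤ v q + c := by
      rcases isEmpty_or_nonempty β with hβ | hβ
      · exact ⟨0, fun q => hβ.elim q, fun q => hβ.elim q⟩
      · obtain ⟨i, hi⟩ := Finite.exists_min u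
        exact ⟨u i, hi, fun q => by linarith [huv i q, hW0 i q]⟩
    let D : Finset β := Finset.univ.filter fun q => u q + v q = (k : ℤ) - 1
    have hdiag : ∀ q, (k : ℤ) - 1 ≤ u q + v q := by
      intro q; have := huv q q; simpa [W] using this
    let A : Fin k → Set β := fun i => {q | u q + v q = (k : ℤ) - 1 ∧ u q - c = (i : ℕ)}
    have hA : ∀ i, IsAntichain (· ≤ ·) (A i) := by
      intro i a ha b hb hne hab
      have hlt : a < b := lt_of_le_of_ne hab hne
      have := huv a b
      simp only [W, hlt, if_true] at this
      have h1 := ha.2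
      have h2 := hb.1
      have h3 := hb.2
      linarith
    have hU : (⋃ i, A i) = (D : Set β) := by
      ext q
      simp only [Set.mem_iUnion, A, D, Set.mem_ofPred_eq, Finset.coe_filter, Finset.mem_univ,
        true_and]
      constructor
      · rintro ⟨_, h, _⟩; exact h
      · intro h
        have h1 := hcu q
        have h2 := hcv q
        refine ⟨⟨(u q - c).toNat, by omega⟩, h, ?_⟩
        simp only
        omega
    have hD : D.card ≤ dk β k := by
      refine le_csSup (dk_bdd β k) ⟨A, hA, ?_⟩
      rw [hU, Set.ncard_coe_finset]
    refine le_trans ?_ hD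
    have hs1 : ∑ q, W q (σ q) = ∑ q, (u q + v q) := by
      rw [Finset.sum_congr rfl fun q _ => ht q, Finset.sum_add_distrib, Finset.sum_add_distrib,
        Equiv.sum_comp σ v]
    have hs2 : ∑ q : β, ((k : ℤ) - if q ∈ D then 1 else 0) ≤ ∑ q, (u q + v q) := by
      refine Finset.sum_le_sum fun q _ => ?_
      have := hdiag q
      by_cases hq : u q + v q = (k : ℤ) - 1
      · simp [D, hq]
      · simp only [D, Finset.mem_filter, Finset.mem_univ, true_and, hq, if_false]
        omega
    have hs3 : ∑ q : β, ((k : ℤ) - W q (σ q)) =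
        ∑ q : β, ((if q ∈ R then (1 : ℤ) else 0) + if q ∈ E then (k : ℤ) else 0) := by
      refine Finset.sum_congr rfl fun q _ => ?_
      by_cases h1 : σ q = q
      · simp [W, R, E, h1]
      · have h1' : q ≠ σ q := fun h => h1 h.symm
        by_cases h2 : q < σ q
        · simp [W, R, E, h1, h2]
        · simp [W, R, E, h1, h2, h1']
    simp only [Finset.sum_add_distrib, Finset.sum_sub_distrib, Finset.sum_ite_mem,
      Finset.univ_inter, Finset.sum_const, nsmul_eq_mul, mul_one] at hs1 hs2 hs3
    have : (R.card : ℤ) + k * E.card ≤ D.card := by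
      have := mul_comm (k : ℤ) (E.card : ℤ)
      linarith
    exact_mod_cast this

theorem weak_duality_aux {α β : Type} [Fintype α] [PartialOrder α] [Fintype β] [PartialOrder β]
    {S : Set (α × β)} (hS : IsSemiantichain S) {n : ℕ} {U : Fin n → Set (α × β)}
    (hU : ∀ i, IsUnichain (U i)) (hc : (⋃ i, U i) = Set.univ) : S.ncard ≤ n := by
  have h1 : ∀ x : α × β, ∃ i, x ∈ U i := by
    intro x
    have : x ∈ ⋃ i, U i := hc ▸ Set.mem_univ x
    simpa using this
  choose φ hφ using h1
  have hinj : Function.Injective (fun x : S => φ x.1) := by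
    intro x y hxy
    by_contra hne
    refine hS x.1 x.2 y.1 y.2 (fun h => hne (Subtype.ext h)) (U (φ x.1)) (hU _) ⟨hφ _, ?_⟩
    have : φ x.1 = φ y.1 := hxy
    rw [this]; exact hφ _
  have := Nat.card_le_card_of_injective _ hinj
  simpa using this

theorem exists_cover_aux {α β : Type} [Fintype α] [PartialOrder α] [Fintype β] [PartialOrder β]
    (w h : ℕ) (f : α ≃ Fin w × Fin h)
    (hf : ∀ a b : α, (f a).1 = (f b).1 → (f a).2 ≤ (f b).2 → a ≤ b) :
    ∃ n ≤ w * dk β h, ∃ U : Fin n → Set (α × β),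
      (∀ i, IsUnichain (U i)) ∧ (⋃ i, U i) = Set.univ := by
  classical
  rcases Nat.eq_zero_or_pos h with rfl | hpos
  · refine ⟨0, Nat.zero_le _, fun i => i.elim0, fun i => i.elim0, ?_⟩
    ext x
    exact (f x.1).2.elim0
  obtain ⟨R, E, C, hC, hcov, hcard⟩ := greene_kleitman_aux β h hpos
  let I := (Fin w × R) ⊕ (α × E)
  let V : I → Set (α × β) := Sum.elim
    (fun x => {p | (f p).1 = x.1} ×ˢ {x.2.1}) (fun x => {x.1} ×ˢ C x.2.1)
  have hI : Fintype.card I = w * (R.card + h * E.card) := by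
    simp only [I, Fintype.card_sum, Fintype.card_prod, Fintype.card_coe, Fintype.card_fin,
      Fintype.card_congr f]
    ring
  refine ⟨Fintype.card I, ?_, fun i => V ((Fintype.equivFin I).symm i), ?_, ?_⟩
  · rw [hI]; exact Nat.mul_le_mul_left _ hcard
  · intro i
    change IsUnichain (V ((Fintype.equivFin I).symm i))
    generalize (Fintype.equivFin I).symm i = y
    rcases y with x | x
    · refine Or.inr ⟨x.2.1, {p | (f p).1 = x.1}, ?_, rfl⟩
      intro a ha b hb _
      have hab : (f a).1 = (f b).1 := Eq.trans ha (Eq.symm hb)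
      rcases le_total (f a).2 (f b).2 with hl | hl
      · exact Or.inl (hf _ _ hab hl)
      · exact Or.inr (hf _ _ hab.symm hl)
    · exact Or.inl ⟨x.1, C x.2.1, hC _, rfl⟩
  · refine Set.eq_univ_of_forall fun x => Set.mem_iUnion.2 ?_
    rcases hcov x.2 with hx | ⟨e, he, hx⟩
    · refine ⟨Fintype.equivFin I (Sum.inl ((f x.1).1, ⟨x.2, hx⟩)), ?_⟩
      simp [V]
    · refine ⟨Fintype.equivFin I (Sum.inr (x.1, ⟨e, he⟩)), ?_⟩
      simp [V, hx]

theorem exists_semiantichain_aux {α β : Type} [Fintype α] [PartialOrder α] [Fintype β]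
    [PartialOrder β] (w h : ℕ) (g : α → Fin h)
    (hg : ∀ j : Fin h, (Finset.univ.filter fun a : α => g a = j).card = w)
    (hg2 : ∀ a b : α, a ≤ b → a = b ∨ g a < g b) :
    ∃ S : Set (α × β), IsSemiantichain S ∧ S.ncard = w * dk β h := by
  classical
  obtain ⟨A, hA, hcard⟩ : dk β h ∈ {n | ∃ A : Fin h → Set β,
      (∀ i, IsAntichain (· ≤ ·) (A i)) ∧ (⋃ i, A i).ncard = n} :=
    Nat.sSup_mem ⟨_, fun _ => ∅, fun _ => Set.pairwise_empty _, rfl⟩ (dk_bdd β h)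
  have hlev : ∀ q : (⋃ i, A i : Set β), ∃ i, q.1 ∈ A i := fun q => Set.mem_iUnion.1 q.2
  choose l hl using hlev
  let F : Finset (Σ _ : (⋃ i, A i : Set β), α) :=
    Finset.univ.sigma fun q => Finset.univ.filter fun a => g a = l q
  let φ : (Σ _ : (⋃ i, A i : Set β), α) → α × β := fun x => (x.2, x.1.1)
  have hφ : Function.Injective φ := by
    rintro ⟨q, a⟩ ⟨q', a'⟩ hx
    simp only [φ, Prod.mk.injEq] at hx
    obtain ⟨rfl, h2⟩ := hx
    obtain rfl := Subtype.ext h2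
    rfl
  refine ⟨((F.image φ : Finset (α × β)) : Set (α × β)), ?_, ?_⟩
  · intro x hx y hy hne U hU hxy
    simp only [Finset.coe_image, Set.mem_image, Finset.mem_coe] at hx hy
    obtain ⟨⟨q, a⟩, hqa, rfl⟩ := hx
    obtain ⟨⟨q', a'⟩, hqa', rfl⟩ := hy
    simp only [F, Finset.mem_sigma, Finset.mem_univ, Finset.mem_filter, true_and] at hqa hqa'
    rcases hU with ⟨p, C, hC, rfl⟩ | ⟨p, C, hC, rfl⟩
    · simp only [φ, Set.mem_prod, Set.mem_singleton_iff] at hxy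
      obtain ⟨⟨rfl, h1⟩, ⟨rfl, h2⟩⟩ := hxy
      have hll : l q = l q' := hqa.symm.trans hqa'
      have hqq : q.1 ≠ q'.1 := by
        intro h; apply hne; simp [φ, h]
      have m1 : q.1 ∈ A (l q) := hl q
      have m2 : q'.1 ∈ A (l q) := hll ▸ hl q'
      rcases hC h1 h2 hqq with h | h
      · exact hA _ m1 m2 hqq h
      · exact hA _ m2 m1 hqq.symm h
    · simp only [φ, Set.mem_prod, Set.mem_singleton_iff] at hxy
      obtain ⟨⟨h1, e1⟩, ⟨h2, e2⟩⟩ := hxy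
      have hqq : q = q' := Subtype.ext (e1.trans e2.symm)
      subst hqq
      have haa : a ≠ a' := by
        rintro rfl; exact hne rfl
      rcases hC h1 h2 haa with h | h
      · rcases hg2 _ _ h with h | h
        · exact haa h
        · rw [hqa, hqa'] at h; exact lt_irrefl _ h
      · rcases hg2 _ _ h with h | h
        · exact haa h.symm
        · rw [hqa, hqa'] at h; exact lt_irrefl _ h
  · rw [Set.ncard_coe_finset, Finset.card_image_of_injective _ hφ, Finset.card_sigma,
      Finset.sum_congr rfl fun q _ => hg (l q), Finset.sum_const, smul_eq_mul, mul_comm,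
      Finset.card_univ, ← hcard, ← Nat.card_eq_fintype_card, Nat.card_coe_set_eq]

/-- If `P` is rectangular of width `w` and height `h`, then for every finite
poset `Q` the maximum size of a semiantichain in `P × Q` equals the minimum
number of unichains needed to cover `P × Q`, and this common value is
`w · d_h(Q)`. -/
theorem semiantichain_unichain_duality_of_rectangular
    (α β : Type) [Fintype α] [PartialOrder α] [Fintype β] [PartialOrder β]
    (w h : ℕ) (hrect : IsRectangular α w h) :
    maxSemiantichain α β = minUnichainCover α β ∧
    maxSemiantichain α β = w * dk β h := by
  obtain ⟨⟨f, hf⟩, g, hg, hg2⟩ := hrect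
  obtain ⟨n, hn, U, hU, hc⟩ := exists_cover_aux (β := β) w h f hf
  obtain ⟨S, hS, hScard⟩ := exists_semiantichain_aux (β := β) w h g hg hg2
  have h1 : w * dk β h ≤ maxSemiantichain α β := by
    refine le_csSup ⟨n, ?_⟩ ⟨S, hS, hScard⟩
    rintro m ⟨S', hS', rfl⟩
    exact weak_duality_aux hS' hU hc
  have h2 : minUnichainCover α β ≤ w * dk β h := le_trans (Nat.sInf_le ⟨U, hU, hc⟩) hn
  have h3 : maxSemiantichain α β ≤ minUnichainCover α β := by
    obtain ⟨U', hU', hc'⟩ : minUnichainCover α β ∈ {n | ∃ U : Fin n → Set (α × β),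
        (∀ i, IsUnichain (U i)) ∧ (⋃ i, U i) = Set.univ} := Nat.sInf_mem ⟨n, U, hU, hc⟩
    refine csSup_le ⟨_, S, hS, rfl⟩ ?_
    rintro m ⟨S', hS', rfl⟩
    exact weak_duality_aux hS' hU' hc'
  omega
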